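/- arXiv:2204.08298 — 2 statements merged into one kernel-verified Lean document; each statement's English description precedes it below -/
import Mathlib

section
/- For the hidden-quantum-memory circuit, the full four-time statistics equal P(x_4, x_3, x_2, x_1) = 1/8 if x_3 = 0 and 0 if x_3 = 1, for all x_1, x_2, x_4 ∈ Fin 2; that is, the trace of the subnormalised final state obtained by measuring at all four times takes exactly these values. -/
open Matrix Kronecker

noncomputable section

/-- Standard-basis projector `|x⟩⟨x|` on a qubit. -/
def proj (x : Fin 2) : Matrix (Fin 2) (Fin 2) ℂ := Matrix.single x x 1

/-- Sharp standard-basis measurement on a qubit: `𝒫^x(A) = |x⟩⟨x| A |x⟩⟨x|`. -/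
def measM (x : Fin 2) (A : Matrix (Fin 2) (Fin 2) ℂ) : Matrix (Fin 2) (Fin 2) ℂ :=
  proj x * A * proj x

/-- Optionally measure a qubit: `some x` applies `𝒫^x`, `none` applies the identity. -/
def optMeas (o : Option (Fin 2)) (A : Matrix (Fin 2) (Fin 2) ℂ) :
    Matrix (Fin 2) (Fin 2) ℂ :=
  o.elim A fun x => measM x A

/-- The Hadamard gate `H = (1/√2)·!![1,1;1,-1]`. -/
def Hgate : Matrix (Fin 2) (Fin 2) ℂ := (Real.sqrt 2 : ℂ)⁻¹ • !![1, 1; 1, -1]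

/-- The two-qubit SWAP unitary (first factor = system, second = environment). -/
def SWAPm : Matrix (Fin 2 × Fin 2) (Fin 2 × Fin 2) ℂ :=
  Matrix.of fun p q => if p.1 = q.2 ∧ p.2 = q.1 then 1 else 0

/-- The two-qubit CNOT with the environment (second factor) as control and the
system (first factor) as target: `|s,e⟩ ↦ |s+e, e⟩`. -/
def CNOTE : Matrix (Fin 2 × Fin 2) (Fin 2 × Fin 2) ℂ :=
  Matrix.of fun p q => if p.2 = q.2 ∧ p.1 = q.1 + q.2 then 1 else 0

/-- Kraus operator `|0⟩⟨+|` of the channel `Υ`. -/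
def K0 : Matrix (Fin 2) (Fin 2) ℂ := (Real.sqrt 2 : ℂ)⁻¹ • !![1, 1; 0, 0]

/-- Kraus operator `|1⟩⟨−|` of the channel `Υ`. -/
def K1 : Matrix (Fin 2) (Fin 2) ℂ := (Real.sqrt 2 : ℂ)⁻¹ • !![0, 0; 1, -1]

/-- The channel `id ⊗ Υ` acting on system ⊗ environment, where `Υ` has Kraus
operators `|0⟩⟨+|` and `|1⟩⟨−|` and acts on the environment. -/
def idTensorUps (A : Matrix (Fin 2 × Fin 2) (Fin 2 × Fin 2) ℂ) :
    Matrix (Fin 2 × Fin 2) (Fin 2 × Fin 2) ℂ :=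
  ((1 : Matrix (Fin 2) (Fin 2) ℂ) ⊗ₖ K0) * A * ((1 : Matrix (Fin 2) (Fin 2) ℂ) ⊗ₖ K0)ᴴ +
    ((1 : Matrix (Fin 2) (Fin 2) ℂ) ⊗ₖ K1) * A * ((1 : Matrix (Fin 2) (Fin 2) ℂ) ⊗ₖ K1)ᴴ

/-- Sharp standard-basis measurement of the system qubit of a two-qubit state. -/
def measSys (x : Fin 2) (A : Matrix (Fin 2 × Fin 2) (Fin 2 × Fin 2) ℂ) :
    Matrix (Fin 2 × Fin 2) (Fin 2 × Fin 2) ℂ :=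
  (proj x ⊗ₖ (1 : Matrix (Fin 2) (Fin 2) ℂ)) * A * (proj x ⊗ₖ (1 : Matrix (Fin 2) (Fin 2) ℂ))

/-- The two-qubit (system ⊗ environment) state of the hidden-quantum-memory circuit
(Fig. 2) just before the measurement at time `t₃`: start from `ρ₁ = 𝟙/2`, optionally
measure (`m₁`), apply `H`, optionally measure (`m₂`), adjoin the environment in state
`τ = |0⟩⟨0|` and apply SWAP. -/
def hqmPre3 (m1 m2 : Option (Fin 2)) : Matrix (Fin 2 × Fin 2) (Fin 2 × Fin 2) ℂ :=
  let ρ1 : Matrix (Fin 2) (Fin 2) ℂ := (1 / 2 : ℂ) • 1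
  let a1 := optMeas m1 ρ1
  let a2 := Hgate * a1 * Hgateᴴ
  let a3 := optMeas m2 a2
  SWAPm * (a3 ⊗ₖ proj 0) * SWAPmᴴ

/-- The final subnormalised two-qubit state of the hidden-quantum-memory circuit
(Fig. 2): after `hqmPre3`, measure the system (`𝒫^{x₃}`), apply `id ⊗ Υ`, apply
`CNOT` controlled on the environment, and measure the system (`𝒫^{x₄}`). -/
def hqmFinal (m1 m2 : Option (Fin 2)) (x3 x4 : Fin 2) :
    Matrix (Fin 2 × Fin 2) (Fin 2 × Fin 2) ℂ :=
  measSys x4 (CNOTE * idTensorUps (measSys x3 (hqmPre3 m1 m2)) * CNOTEᴴ)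

/-- The scalar `(1/√2)·(1/√2)` is `1/2`. -/
theorem invSqrt_mul : ((Real.sqrt 2 : ℝ) : ℂ)⁻¹ * ((Real.sqrt 2 : ℝ) : ℂ)⁻¹ = 1 / 2 := by
  rw [← mul_inv, ← Complex.ofReal_mul, Real.mul_self_sqrt (by norm_num)]
  norm_num

theorem sys_state (x1 x2 : Fin 2) :
    measM x2 (Hgate * measM x1 ((1 / 2 : ℂ) • 1) * Hgateᴴ) = (1 / 4 : ℂ) • proj x2 := by
  have h := invSqrt_mul
  ext i j
  fin_cases x1 <;> fin_cases x2 <;> fin_cases i <;> fin_cases j <;>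
    simp [measM, Hgate, proj, Matrix.mul_apply, Fin.sum_univ_two, Matrix.single_apply,
        Matrix.vecMul, dotProduct] <;>
    linear_combination (1 / 2 : ℂ) * h

theorem swap_state (A B : Matrix (Fin 2) (Fin 2) ℂ) :
    SWAPm * (A ⊗ₖ B) * SWAPmᴴ = B ⊗ₖ A := by
  ext ⟨i, j⟩ ⟨k, l⟩
  fin_cases i <;> fin_cases j <;> fin_cases k <;> fin_cases l <;>
    simp [SWAPm, Matrix.mul_apply, Fintype.sum_prod_type, Fin.sum_univ_two] <;>
    ring

theorem ups_state (A : Matrix (Fin 2) (Fin 2) ℂ) (c : ℂ) (x : Fin 2) :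
    idTensorUps (A ⊗ₖ (c • proj x)) = (c / 2) • (A ⊗ₖ (1 : Matrix (Fin 2) (Fin 2) ℂ)) := by
  have h := invSqrt_mul
  have h0 : K0 * (c • proj x) * K0ᴴ = (c / 2) • proj 0 := by
    ext i j
    fin_cases x <;> fin_cases i <;> fin_cases j <;>
      simp [K0, proj, Matrix.mul_apply, Fin.sum_univ_two, Matrix.single_apply,
        Matrix.vecMul, dotProduct] <;>
      linear_combination c * h
  have h1 : K1 * (c • proj x) * K1ᴴ = (c / 2) • proj 1 := by
    ext i j
    fin_cases x <;> fin_cases i <;> fin_cases j <;>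
      simp [K1, proj, Matrix.mul_apply, Fin.sum_univ_two, Matrix.single_apply,
        Matrix.vecMul, dotProduct] <;>
      linear_combination c * h
  have h2 : proj 0 + proj 1 = 1 := by
    ext i j
    fin_cases i <;> fin_cases j <;> simp [proj, Matrix.single_apply]
  unfold idTensorUps
  simp only [conjTranspose_kronecker, ← mul_kronecker_mul, conjTranspose_one, one_mul, mul_one,
    h0, h1]
  rw [← kronecker_add, ← smul_add, h2, kronecker_smul]

theorem measSys_kron (x : Fin 2) (A B : Matrix (Fin 2) (Fin 2) ℂ) :
    measSys x (A ⊗ₖ B) = measM x A ⊗ₖ B := by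
  simp [measSys, measM, ← mul_kronecker_mul]

theorem measM_proj (x y : Fin 2) : measM x (proj y) = if x = y then proj y else 0 := by
  ext i j
  fin_cases x <;> fin_cases y <;> fin_cases i <;> fin_cases j <;>
    simp [measM, proj, Matrix.mul_apply, Fin.sum_univ_two, Matrix.single_apply]

theorem final_trace (c : ℂ) (x : Fin 2) :
    (measSys x (CNOTE * (c • (proj 0 ⊗ₖ (1 : Matrix (Fin 2) (Fin 2) ℂ))) * CNOTEᴴ)).trace = c := by
  fin_cases x <;>
    simp [measSys, CNOTE, proj, Matrix.trace, Matrix.mul_apply, Fintype.sum_prod_type,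
      Fin.sum_univ_two, Matrix.single_apply, Matrix.one_apply]

/-- For the hidden-quantum-memory circuit, the full four-time statistics equal
`P(x₄,x₃,x₂,x₁) = 1/8` if `x₃ = 0` and `0` if `x₃ = 1`, for all `x₁, x₂, x₄`. -/
theorem hqm_full_statistics (x1 x2 x3 x4 : Fin 2) :
    (hqmFinal (some x1) (some x2) x3 x4).trace =
      if x3 = 0 then (1 / 8 : ℂ) else 0 := by
  have h : hqmPre3 (some x1) (some x2) = proj 0 ⊗ₖ ((1 / 4 : ℂ) • proj x2) := by
    have := sys_state x1 x2
    simp only [hqmPre3, optMeas, Option.elim, this, swap_state]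
  rw [hqmFinal, h, measSys_kron, ups_state, measM_proj]
  by_cases h3 : x3 = 0
  · rw [if_pos h3, if_pos h3, final_trace]
    norm_num
  · rw [if_neg h3, if_neg h3]
    simp [measSys]
end
end

section
/- For the hidden-quantum-memory circuit, the sub-statistics obtained by NOT measuring at time t_2 (applying the identity there instead) equal P(x_4, x_3, 𝓘_2, x_1) = 1/2 if x_3 = 0 and x_4 = x_1, and 0 otherwise, for all x_1, x_3, x_4 ∈ Fin 2. -/
open Matrix Kronecker

noncomputable section

/-- Entries of a measured two-qubit state. -/
theorem measSys_entry (x : Fin 2) (A : Matrix (Fin 2 × Fin 2) (Fin 2 × Fin 2) ℂ)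
    (a b c d : Fin 2) :
    measSys x A (a, b) (c, d) = if a = x ∧ c = x then A (a, b) (c, d) else 0 := by
  fin_cases x <;> fin_cases a <;> fin_cases b <;> fin_cases c <;> fin_cases d <;>
    simp [measSys, proj, Matrix.mul_apply, Fintype.sum_prod_type, Matrix.single_apply,
      Matrix.one_apply]

/-- Conjugation by SWAP permutes entries. -/
theorem swap_entry (A : Matrix (Fin 2 × Fin 2) (Fin 2 × Fin 2) ℂ) (a b c d : Fin 2) :
    (SWAPm * A * SWAPmᴴ) (a, b) (c, d) = A (b, a) (d, c) := by
  fin_cases a <;> fin_cases b <;> fin_cases c <;> fin_cases d <;>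
    simp [SWAPm, Matrix.mul_apply, Fintype.sum_prod_type]

/-- Conjugation by CNOT permutes entries. -/
theorem cnot_entry (A : Matrix (Fin 2 × Fin 2) (Fin 2 × Fin 2) ℂ) (a b c d : Fin 2) :
    (CNOTE * A * CNOTEᴴ) (a, b) (c, d) = A (a + b, b) (c + d, d) := by
  fin_cases a <;> fin_cases b <;> fin_cases c <;> fin_cases d <;>
    simp [CNOTE, Matrix.mul_apply, Fintype.sum_prod_type]

theorem sqrt_two_inv_mul : (Real.sqrt 2 : ℂ)⁻¹ * (Real.sqrt 2 : ℂ)⁻¹ = 1 / 2 := by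
  rw [← mul_inv, ← Complex.ofReal_mul, Real.mul_self_sqrt (by norm_num)]
  norm_num

/-- Diagonal environment entries after `id ⊗ Υ`. -/
theorem ups_entry (A : Matrix (Fin 2 × Fin 2) (Fin 2 × Fin 2) ℂ) (a b : Fin 2) :
    idTensorUps A (a, b) (a, b) =
      1 / 2 * (A (a, 0) (a, 0) + A (a, 1) (a, 1)
        + (if b = 0 then 1 else -1) * (A (a, 0) (a, 1) + A (a, 1) (a, 0))) := by
  rw [← sqrt_two_inv_mul]
  fin_cases a <;> fin_cases b <;>
    simp [idTensorUps, K0, K1, Matrix.mul_apply, Fintype.sum_prod_type] <;> ring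

/-- The system state after preparation, first measurement and Hadamard. -/
theorem had_entry (x a b : Fin 2) :
    (Hgate * optMeas (some x) ((1 / 2 : ℂ) • 1) * Hgateᴴ) a b =
      1 / 4 * (if x = 1 ∧ a ≠ b then -1 else 1) := by
  have h : (1 / 4 : ℂ) = 1 / 2 * ((Real.sqrt 2 : ℂ)⁻¹ * (Real.sqrt 2 : ℂ)⁻¹) := by
    rw [sqrt_two_inv_mul]; norm_num
  rw [h]
  fin_cases x <;> fin_cases a <;> fin_cases b <;>
    simp [optMeas, measM, proj, Hgate, Matrix.mul_apply, Matrix.single_apply,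
      Matrix.vecMul, dotProduct] <;> ring

theorem pre_entry (x a b c d : Fin 2) :
    hqmPre3 (some x) none (a, b) (c, d) =
      if a = 0 ∧ c = 0 then 1 / 4 * (if x = 1 ∧ b ≠ d then -1 else 1) else 0 := by
  have e : hqmPre3 (some x) none = SWAPm *
      ((Hgate * optMeas (some x) ((1 / 2 : ℂ) • 1) * Hgateᴴ) ⊗ₖ proj 0) * SWAPmᴴ := rfl
  rw [e, swap_entry, Matrix.kroneckerMap_apply, had_entry]
  fin_cases a <;> fin_cases c <;> simp [proj]

/-- For the hidden-quantum-memory circuit, the sub-statistics obtained by *not*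
measuring at time `t₂` (applying the identity there instead) equal
`P(x₄,x₃,𝓘₂,x₁) = 1/2` if `x₃ = 0` and `x₄ = x₁`, and `0` otherwise. -/
theorem hqm_substatistics_no_t2 (x1 x3 x4 : Fin 2) :
    (hqmFinal (some x1) none x3 x4).trace =
      if x3 = 0 ∧ x4 = x1 then (1 / 2 : ℂ) else 0 := by
  simp only [hqmFinal, Matrix.trace, Matrix.diag, Fintype.sum_prod_type, Fin.sum_univ_two,
    measSys_entry, cnot_entry, ups_entry, pre_entry]
  fin_cases x1 <;> fin_cases x3 <;> fin_cases x4 <;>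
    norm_num [show (1 : Fin 2) + 1 = 0 from rfl]
end
end
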